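/- arXiv:0812.0022 — 2 statements merged into one kernel-verified Lean document; each statement's English description precedes it below -/
import Mathlib

section
/- Multi-step intertwining in the geometric-jump case: with the one-step kernels q on W^{n,n+1} and p_Y on W^{n+1} as defined, define iterated kernels by q^{(1)} = q, q^{(t+1)}((x,y),(x″,y″)) = Σ_{(x′,y′) ∈ W^{n,n+1}} q^{(t)}((x,y),(x′,y′)) q((x′,y′),(x″,y″)), and p_Y^{(1)} = p_Y, p_Y^{(t+1)}(y,y″) = Σ_{y′ ∈ W^{n+1}} p_Y^{(t)}(y,y′) p_Y(y′,y″) (sums of nonnegative terms). Then for every integer t ≥ 1, every y ∈ W^{n+1} and every (x′,y′) ∈ W^{n,n+1}: m(x′,y′) · p_Y^{(t)}(y,y′) = Σ_{x ∈ W^n : x ⪯ y} m(x,y) · q^{(t)}((x,y),(x′,y′)). -/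
open scoped BigOperators

noncomputable section

/-- Sum of the entries of an integer vector. -/
def vsum {n : ℕ} (z : Fin n → ℤ) : ℤ := ∑ i, z i

/-- `Interlace x y` means `x ⪯ y`, i.e. `y_i ≤ x_i ≤ y_{i+1}` for `1 ≤ i ≤ n`. -/
def Interlace {n : ℕ} (x : Fin n → ℤ) (y : Fin (n + 1) → ℤ) : Prop :=
  ∀ i : Fin n, y i.castSucc ≤ x i ∧ x i ≤ y i.succ

/-- `PrecEq x x'` means `x ≺ x'`: `x_1 ≤ x'_1 ≤ x_2 ≤ x'_2 ≤ … ≤ x_n ≤ x'_n`. -/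
def PrecEq {k : ℕ} (x x' : Fin k → ℤ) : Prop :=
  (∀ i, x i ≤ x' i) ∧ ∀ (i : ℕ) (h : i + 1 < k), x' ⟨i, Nat.lt_of_succ_lt h⟩ ≤ x ⟨i + 1, h⟩

/-- `p` encodes an integer Gelfand–Tsetlin pattern with rows `1, …, n`. -/
def IsGT (n : ℕ) (p : ℕ → ℕ → ℤ) : Prop :=
  (∀ k i, 1 ≤ k → k < n → i < k → p (k + 1) i ≤ p k i ∧ p k i ≤ p (k + 1) (i + 1)) ∧
  (∀ r i, r = 0 ∨ n < r ∨ r ≤ i → p r i = 0)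

/-- `|x^r|`, the sum of the entries of row `r`. -/
def rowSum (p : ℕ → ℕ → ℤ) (r : ℕ) : ℤ := ∑ i ∈ Finset.range r, p r i

/-- The geometric weight `w^q(x) = ∏_{i=1}^n q_i^{|x^i| - |x^{i-1}|}` (0-based rates). -/
def wGT (n : ℕ) (q : ℕ → ℝ) (p : ℕ → ℕ → ℤ) : ℝ :=
  ∏ k ∈ Finset.range n, q k ^ (rowSum p (k + 1) - rowSum p k)

/-- `K_n(z)`: the Gelfand–Tsetlin patterns with bottom row `z`. -/
def GTset (n : ℕ) (z : Fin n → ℤ) : Set (ℕ → ℕ → ℤ) :=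
  {p | IsGT n p ∧ ∀ i : Fin n, p n i = z i}

/-- The Schur function `S_z(q_1, …, q_n)`. -/
def Schur (n : ℕ) (q : ℕ → ℝ) (z : Fin n → ℤ) : ℝ :=
  ∑ᶠ p ∈ GTset n z, wGT n q p

/-- The "blocking" factor `b(u,v) = (1−q)·1{v < u} + 1{u = v}`. -/
def bfactor (q : ℝ) (u v : ℤ) : ℝ :=
  (1 - q) * (if v < u then 1 else 0) + (if u = v then 1 else 0)

/-- The "pushing" factor `c(u,v) = q^{−v}·1{u ≤ v} + q^{−u}·1{u > v}`. -/
def cfactor (q : ℝ) (u v : ℤ) : ℝ :=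
  q ^ (-v) * (if u ≤ v then 1 else 0) + q ^ (-u) * (if v < u then 1 else 0)

/-- The conditional probability factor
`r(y′,x′,x,y) = q_{n+1}^{y′_1−y_1} b(x_1,y′_1) ·
[∏_{i=2}^n q_{n+1}^{y′_i} b(x_i,y′_i) c(x′_{i−1},y_i)] ·
q_{n+1}^{y′_{n+1}} (1−q_{n+1}) c(x′_n, y_{n+1})`, here with `n+1` points in `x`. -/
def rfactor (n : ℕ) (qv : ℝ) (y' : Fin (n + 2) → ℤ) (x' : Fin (n + 1) → ℤ)
    (x : Fin (n + 1) → ℤ) (y : Fin (n + 2) → ℤ) : ℝ :=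
  qv ^ (y' 0 - y 0) * bfactor qv (x 0) (y' 0) *
    (∏ j ∈ Finset.univ.filter (fun j : Fin (n + 1) => 1 ≤ j.val),
      qv ^ (y' j.castSucc) * bfactor qv (x j) (y' j.castSucc) *
        cfactor qv (x' ⟨j.val - 1, lt_of_le_of_lt (Nat.sub_le _ _) j.isLt⟩) (y j.castSucc)) *
    (qv ^ (y' (Fin.last (n + 1))) * (1 - qv) * cfactor qv (x' (Fin.last n)) (y (Fin.last (n + 1))))

open Classical in
/-- The one-step transition kernel `q((x,y),(x′,y′))` of the coupled chain on `W^{n,n+1}`. -/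
def qker (n : ℕ) (q : ℕ → ℝ) (x : Fin (n + 1) → ℤ) (y : Fin (n + 2) → ℤ)
    (x' : Fin (n + 1) → ℤ) (y' : Fin (n + 2) → ℤ) : ℝ :=
  if PrecEq x x' ∧ PrecEq y y' ∧ Interlace x y ∧ Interlace x' y' then
    rfactor n (q (n + 1)) y' x' x y * (∏ i ∈ Finset.range (n + 1), (1 - q i)) *
      Schur (n + 1) q x' / Schur (n + 1) q x
  else 0

open Classical in
/-- The transition kernel `p_Y(y,y′) = a(q̃) S_{y′}(q̃)/S_y(q̃) · 1{y ≺ y′}` on `W^{n+1}`. -/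
def pYker (n : ℕ) (q : ℕ → ℝ) (y y' : Fin (n + 2) → ℤ) : ℝ :=
  if PrecEq y y' then
    (∏ i ∈ Finset.range (n + 2), (1 - q i)) * Schur (n + 2) q y' / Schur (n + 2) q y
  else 0

/-- `m(x,y) = q_{n+1}^{|y|−|x|} S_x(q)/S_y(q̃)`. -/
def mGeo (n : ℕ) (q : ℕ → ℝ) (x : Fin (n + 1) → ℤ) (y : Fin (n + 2) → ℤ) : ℝ :=
  q (n + 1) ^ (vsum y - vsum x) * Schur (n + 1) q x / Schur (n + 2) q y

/-- Iterated kernel: `qiter n q t = q^{(t+1)}`, the `(t+1)`-step kernel on `W^{n,n+1}`,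
defined by `q^{(1)} = q` and
`q^{(t+1)}((x,y),(x″,y″)) = Σ_{(x′,y′) ∈ W^{n,n+1}} q^{(t)}((x,y),(x′,y′)) q((x′,y′),(x″,y″))`. -/
def qiter (n : ℕ) (q : ℕ → ℝ) :
    ℕ → (Fin (n + 1) → ℤ) → (Fin (n + 2) → ℤ) → (Fin (n + 1) → ℤ) → (Fin (n + 2) → ℤ) → ℝ
  | 0 => qker n q
  | (t + 1) => fun x y x'' y'' =>
      ∑' s : {s : (Fin (n + 1) → ℤ) × (Fin (n + 2) → ℤ) //
          Monotone s.1 ∧ Monotone s.2 ∧ Interlace s.1 s.2},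
        qiter n q t x y s.1.1 s.1.2 * qker n q s.1.1 s.1.2 x'' y''

/-- Iterated kernel: `pYiter n q t = p_Y^{(t+1)}`, the `(t+1)`-step kernel on `W^{n+1}`,
defined by `p_Y^{(1)} = p_Y` and
`p_Y^{(t+1)}(y,y″) = Σ_{y′ ∈ W^{n+1}} p_Y^{(t)}(y,y′) p_Y(y′,y″)`. -/
def pYiter (n : ℕ) (q : ℕ → ℝ) : ℕ → (Fin (n + 2) → ℤ) → (Fin (n + 2) → ℤ) → ℝ
  | 0 => pYker n q
  | (t + 1) => fun y y'' =>
      ∑' y' : {y' : Fin (n + 2) → ℤ // Monotone y'},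
        pYiter n q t y y'.1 * pYker n q y'.1 y''

/-! ### Positivity of Schur functions -/

lemma GTset_finite (n : ℕ) (z : Fin n → ℤ) : (GTset n z).Finite := by
  set M : ℤ := ∑ i, |z i|
  have hz : ∀ i, |z i| ≤ M := fun i =>
    Finset.single_le_sum (f := fun i => |z i|) (fun i _ => abs_nonneg _) (Finset.mem_univ i)
  have hM : 0 ≤ M := Finset.sum_nonneg fun i _ => abs_nonneg _
  have bound : ∀ p ∈ GTset n z, ∀ d r, r + d = n → 1 ≤ r → ∀ i, i < r → |p r i| ≤ M := by
    rintro p ⟨⟨h1, -⟩, h3⟩ d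
    induction d with
    | zero =>
      rintro r rfl - i hi
      simpa [← h3 ⟨i, hi⟩] using hz ⟨i, hi⟩
    | succ d ih =>
      intro r hr hr1 i hi
      obtain ⟨ha, hb⟩ := h1 r i hr1 (by omega) hi
      have hc := abs_le.1 (ih (r + 1) (by omega) (by omega) i (by omega))
      have hd := abs_le.1 (ih (r + 1) (by omega) (by omega) (i + 1) (by omega))
      exact abs_le.2 ⟨by omega, by omega⟩
  refine Set.Finite.of_injOn (t := Set.Icc (fun _ _ => -M) (fun _ _ => M))
    (f := fun p (r : Fin (n + 1)) (i : Fin n) => p r i) ?_ ?_ (Set.finite_Icc _ _)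
  · intro p hp
    have hb : ∀ (r : Fin (n + 1)) (i : Fin n), |p r i| ≤ M := by
      intro r i
      by_cases h : (r : ℕ) = 0 ∨ n < r ∨ (r : ℕ) ≤ i
      · rw [hp.1.2 _ _ h]
        simpa using hM
      · exact bound p hp (n - r) r (by omega) (by omega) i (by omega)
    exact ⟨fun r i => (abs_le.1 (hb r i)).1, fun r i => (abs_le.1 (hb r i)).2⟩
  · intro p hp p' hp' h
    funext r i
    by_cases hri : r = 0 ∨ n < r ∨ r ≤ i
    · rw [hp.1.2 _ _ hri, hp'.1.2 _ _ hri]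
    · exact congrFun (congrFun h ⟨r, by omega⟩) ⟨i, by omega⟩

lemma GTset_nonempty (n : ℕ) (z : Fin n → ℤ) (hz : Monotone z) : (GTset n z).Nonempty := by
  refine ⟨fun r i => if h : i < n ∧ i < r ∧ r ≤ n then z ⟨i, h.1⟩ else 0, ⟨?_, ?_⟩, ?_⟩
  · intro k i hk hkn hi
    dsimp only
    rw [dif_pos ⟨by omega, by omega, by omega⟩, dif_pos ⟨by omega, by omega, by omega⟩,
      dif_pos ⟨by omega, by omega, by omega⟩]
    exact ⟨le_rfl, hz (by simp)⟩
  · intro r i h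
    exact dif_neg (by omega)
  · intro i
    simp

lemma Schur_pos (n : ℕ) (q : ℕ → ℝ) (hq : ∀ i, 0 < q i) (z : Fin n → ℤ) (hz : Monotone z) :
    0 < Schur n q z := by
  have hw : ∀ p, 0 < wGT n q p := fun p => Finset.prod_pos fun k _ => zpow_pos (hq k) _
  rw [Schur, finsum_mem_eq_finite_toFinset_sum _ (GTset_finite n z)]
  exact Finset.sum_pos (fun p _ => hw p) (by simpa using GTset_nonempty n z hz)

/-! ### Interlacing sequences -/

lemma Interlace.monotone {n : ℕ} {x : Fin (n + 1) → ℤ} {y : Fin (n + 2) → ℤ}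
    (h : Interlace x y) : Monotone x :=
  Fin.monotone_iff_le_succ.2 fun i => (h i.castSucc).2.trans (h i.succ).1

lemma PrecEq.castSucc_le_succ {n : ℕ} {y y' : Fin (n + 1) → ℤ} (h : PrecEq y y') (i : Fin n) :
    y' i.castSucc ≤ y i.succ :=
  h.2 i.val (by omega)

/-- The finite set of all `x` with `x ⪯ y`. -/
def interlacing {n : ℕ} (y : Fin (n + 1) → ℤ) : Finset (Fin n → ℤ) :=
  Finset.Icc (fun i => y i.castSucc) (fun i => y i.succ)

lemma mem_interlacing {n : ℕ} {x : Fin n → ℤ} {y : Fin (n + 1) → ℤ} :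
    x ∈ interlacing y ↔ Interlace x y := by
  simp only [interlacing, Finset.mem_Icc, Pi.le_def, Interlace, forall_and]

/-! ### The one-step intertwining -/

lemma cfactor_eq (q : ℝ) (u v : ℤ) : cfactor q u v = q ^ (-max u v) := by
  rcases le_or_gt u v with h | h
  · simp [cfactor, h, h.not_gt]
  · simp [cfactor, h, h.not_ge, h.le]

lemma bfactor_of_lt (q : ℝ) {u v : ℤ} (h : u < v) : bfactor q u v = 0 := by
  simp [bfactor, h.ne, h.not_gt]

lemma sum_zpow_mul_bfactor {q : ℝ} (hq : 0 < q) {a b : ℤ} (hab : a ≤ b) :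
    ∑ x ∈ Finset.Icc a b, q ^ (-x) * bfactor q x a = q ^ (-b) := by
  induction b, hab using Int.leInduction with
  | base => simp [bfactor]
  | succ b hab ih =>
    have hI : Finset.Icc a (b + 1) = insert (b + 1) (Finset.Icc a b) := by
      ext x
      simp only [Finset.mem_Icc, Finset.mem_insert]
      omega
    have hb : bfactor q (b + 1) a = 1 - q := by
      simp [bfactor, show a < b + 1 by omega, show b + 1 ≠ a by omega]
    have hz : q ^ (-b) = q * q ^ (-(b + 1)) := by
      rw [← zpow_one_add₀ hq.ne']
      congr 1
      ring
    rw [hI, Finset.sum_insert (by simp), ih, hb, hz]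
    ring

lemma prod_zpow {ι : Type*} (s : Finset ι) {q : ℝ} (hq : 0 < q) (f : ι → ℤ) :
    ∏ i ∈ s, q ^ f i = q ^ ∑ i ∈ s, f i := by
  classical
  induction s using Finset.induction_on with
  | empty => simp
  | insert a s ha ih => rw [Finset.prod_insert ha, Finset.sum_insert ha, zpow_add₀ hq.ne', ih]

lemma rfactor_eq (n : ℕ) {q : ℝ} (hq : 0 < q) (y' : Fin (n + 2) → ℤ) (x' x : Fin (n + 1) → ℤ)
    (y : Fin (n + 2) → ℤ) :
    rfactor n q y' x' x y =
      (1 - q) * q ^ (vsum y' - y 0 - ∑ j, max (x' j) (y j.succ)) *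
        ∏ j, bfactor q (x j) (y' j.castSucc) := by
  have hprod : (∏ j ∈ Finset.univ.filter (fun j : Fin (n + 1) => 1 ≤ j.val),
      q ^ (y' j.castSucc) * bfactor q (x j) (y' j.castSucc) *
        cfactor q (x' ⟨j.val - 1, lt_of_le_of_lt (Nat.sub_le _ _) j.isLt⟩) (y j.castSucc)) =
      ∏ j : Fin n, q ^ (y' j.succ.castSucc) * bfactor q (x j.succ) (y' j.succ.castSucc) *
        q ^ (-max (x' j.castSucc) (y j.succ.castSucc)) := by
    rw [Finset.prod_filter, Fin.prod_univ_succ, if_neg (by simp), one_mul]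
    refine Finset.prod_congr rfl fun j _ => ?_
    rw [if_pos (by simp), cfactor_eq]
    rfl
  have hsum : vsum y' - y 0 - ∑ j, max (x' j) (y j.succ) =
      (y' 0 - y 0) + ∑ j : Fin n, y' j.succ.castSucc +
        ∑ j : Fin n, -max (x' j.castSucc) (y j.succ.castSucc) +
        y' (Fin.last (n + 1)) + -max (x' (Fin.last n)) (y (Fin.last (n + 1))) := by
    rw [vsum, Fin.sum_univ_castSucc y', Fin.sum_univ_succ, Fin.sum_univ_castSucc (n := n)]
    simp only [Finset.sum_neg_distrib, Fin.succ_last, Fin.succ_castSucc, Fin.castSucc_zero]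
    ring
  rw [rfactor, hprod, hsum, cfactor_eq, Finset.prod_mul_distrib, Finset.prod_mul_distrib,
    prod_zpow _ hq, prod_zpow _ hq, Fin.prod_univ_succ (n := n)]
  simp only [zpow_add₀ hq.ne', Fin.castSucc_zero]
  ring

lemma sum_zpow_mul_rfactor (n : ℕ) {q : ℝ} (hq : 0 < q) {y y' : Fin (n + 2) → ℤ}
    {x' : Fin (n + 1) → ℤ} (hy : PrecEq y y') (hx' : Interlace x' y') :
    ∑ x ∈ Fintype.piFinset fun i : Fin (n + 1) =>
        Finset.Icc (y' i.castSucc) (min (x' i) (y i.succ)),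
      q ^ (vsum y - vsum x) * rfactor n q y' x' x y = (1 - q) * q ^ (vsum y' - vsum x') := by
  have hterm : ∀ x : Fin (n + 1) → ℤ, q ^ (vsum y - vsum x) * rfactor n q y' x' x y =
      (1 - q) * q ^ (vsum y + vsum y' - y 0 - ∑ j, max (x' j) (y j.succ)) *
        ∏ j, q ^ (-x j) * bfactor q (x j) (y' j.castSucc) := by
    intro x
    rw [rfactor_eq n hq, Finset.prod_mul_distrib, prod_zpow _ hq, Finset.sum_neg_distrib,
      show vsum y + vsum y' - y 0 - ∑ j, max (x' j) (y j.succ) =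
        vsum y + (vsum y' - y 0 - ∑ j, max (x' j) (y j.succ)) by ring,
      zpow_add₀ hq.ne' (vsum y), sub_eq_add_neg (vsum y) (vsum x), zpow_add₀ hq.ne' (vsum y),
      show vsum x = ∑ i, x i from rfl]
    ring
  have hmm : ∑ j, min (x' j) (y j.succ) + ∑ j, max (x' j) (y j.succ) = vsum x' + (vsum y - y 0) := by
    rw [← Finset.sum_add_distrib, vsum, vsum, Fin.sum_univ_succ y, add_sub_cancel_left,
      ← Finset.sum_add_distrib]
    exact Finset.sum_congr rfl fun j _ => min_add_max _ _
  have hfactor := Finset.prod_univ_sum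
    (fun j : Fin (n + 1) => Finset.Icc (y' j.castSucc) (min (x' j) (y j.succ)))
    fun j u => q ^ (-u) * bfactor q u (y' j.castSucc)
  simp only [hterm]
  rw [← Finset.mul_sum, ← hfactor,
    Finset.prod_congr rfl fun j _ =>
      sum_zpow_mul_bfactor hq (le_min (hx' j).1 (hy.castSucc_le_succ j)),
    prod_zpow _ hq, mul_assoc, ← zpow_add₀ hq.ne', Finset.sum_neg_distrib]
  congr 2
  linarith

lemma one_step_intertwining (n : ℕ) (q : ℕ → ℝ) (hq : ∀ i, 0 < q i)
    {y y' : Fin (n + 2) → ℤ} {x' : Fin (n + 1) → ℤ}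
    (hy' : Monotone y') (hx' : Interlace x' y') :
    mGeo n q x' y' * pYker n q y y' = ∑ x ∈ interlacing y, mGeo n q x y * qker n q x y x' y' := by
  by_cases hyy : PrecEq y y'
  swap
  · simp [pYker, qker, hyy]
  have hsub : (Fintype.piFinset fun i : Fin (n + 1) =>
      Finset.Icc (y' i.castSucc) (min (x' i) (y i.succ))) ⊆ interlacing y := by
    intro x hx
    simp only [Fintype.mem_piFinset, Finset.mem_Icc, le_min_iff] at hx
    exact mem_interlacing.2 fun i => ⟨(hyy.1 _).trans (hx i).1, (hx i).2.2⟩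
  rw [← Finset.sum_subset hsub]
  · have hterm : ∀ x ∈ Fintype.piFinset fun i : Fin (n + 1) =>
        Finset.Icc (y' i.castSucc) (min (x' i) (y i.succ)),
        mGeo n q x y * qker n q x y x' y' =
          (∏ i ∈ Finset.range (n + 1), (1 - q i)) * Schur (n + 1) q x' / Schur (n + 2) q y *
            (q (n + 1) ^ (vsum y - vsum x) * rfactor n (q (n + 1)) y' x' x y) := by
      intro x hx
      have hxy := mem_interlacing.1 (hsub hx)
      simp only [Fintype.mem_piFinset, Finset.mem_Icc, le_min_iff] at hx
      have hxx : PrecEq x x' :=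
        ⟨fun i => (hx i).2.1, fun i h =>
          (hx' ⟨i, Nat.lt_of_succ_lt h⟩).2.trans (hx ⟨i + 1, h⟩).1⟩
      have hS := (Schur_pos (n + 1) q hq x hxy.monotone).ne'
      rw [mGeo, qker, if_pos ⟨hxx, hyy, hxy, hx'⟩]
      field_simp
    rw [Finset.sum_congr rfl hterm, ← Finset.mul_sum, sum_zpow_mul_rfactor n (hq _) hyy hx',
      mGeo, pYker, if_pos hyy, Finset.prod_range_succ _ (n + 1)]
    have hS := (Schur_pos (n + 2) q hq y' hy').ne'
    field_simp
  · intro x hx hxn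
    rw [mul_eq_zero]
    right
    by_cases hxx : PrecEq x x'
    swap
    · simp [qker, hxx]
    obtain ⟨j, hj⟩ : ∃ j, x j < y' j.castSucc := by
      by_contra! hcon
      exact hxn (Fintype.mem_piFinset.2 fun i =>
        Finset.mem_Icc.2 ⟨hcon i, le_min (hxx.1 i) ((mem_interlacing.1 hx) i).2⟩)
    have hr : rfactor n (q (n + 1)) y' x' x y = 0 := by
      rw [rfactor_eq n (hq _), Finset.prod_eq_zero (Finset.mem_univ j) (bfactor_of_lt _ hj),
        mul_zero]
    simp [qker, hr]

/-! ### Iterated kernels as finite sums -/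

lemma pYker_support {n : ℕ} {q : ℕ → ℝ} {y y' : Fin (n + 2) → ℤ} (h : pYker n q y y' ≠ 0) :
    y ≤ y' := by
  by_contra hc
  exact h (if_neg fun hp => hc hp.1)

lemma qker_support {n : ℕ} {q : ℕ → ℝ} {x x' : Fin (n + 1) → ℤ} {y y' : Fin (n + 2) → ℤ}
    (h : qker n q x y x' y' ≠ 0) : y ≤ y' := by
  by_contra hc
  exact h (if_neg fun hp => hc hp.2.1.1)

lemma exists_ne_zero_of_tsum_ne_zero {ι : Type*} {f : ι → ℝ} (h : ∑' i, f i ≠ 0) :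
    ∃ i, f i ≠ 0 := by
  by_contra! hc
  exact h (by simp [hc])

lemma pYiter_support {n : ℕ} {q : ℕ → ℝ} {t : ℕ} {y y' : Fin (n + 2) → ℤ}
    (h : pYiter n q t y y' ≠ 0) : y ≤ y' := by
  induction t generalizing y' with
  | zero => exact pYker_support h
  | succ t ih =>
    obtain ⟨s, hs⟩ := exists_ne_zero_of_tsum_ne_zero h
    exact (ih (left_ne_zero_of_mul hs)).trans (pYker_support (right_ne_zero_of_mul hs))

lemma qiter_support {n : ℕ} {q : ℕ → ℝ} {t : ℕ} {x x' : Fin (n + 1) → ℤ}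
    {y y' : Fin (n + 2) → ℤ} (h : qiter n q t x y x' y' ≠ 0) : y ≤ y' := by
  induction t generalizing x' y' with
  | zero => exact qker_support h
  | succ t ih =>
    obtain ⟨s, hs⟩ := exists_ne_zero_of_tsum_ne_zero h
    exact (ih (left_ne_zero_of_mul hs)).trans (qker_support (right_ne_zero_of_mul hs))

open Classical in
lemma pYiter_succ (n : ℕ) (q : ℕ → ℝ) (t : ℕ) (y y'' : Fin (n + 2) → ℤ) :
    pYiter n q (t + 1) y y'' =
      ∑ y' ∈ (Finset.Icc y y'').filter Monotone, pYiter n q t y y' * pYker n q y' y'' := by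
  have h := tsum_subtype {y' : Fin (n + 2) → ℤ | Monotone y'}
    fun y' => pYiter n q t y y' * pYker n q y' y''
  refine h.trans ?_
  rw [tsum_eq_sum (s := (Finset.Icc y y'').filter Monotone)]
  · refine Finset.sum_congr rfl fun y' hy' => Set.indicator_of_mem ?_ _
    exact (Finset.mem_filter.1 hy').2
  · intro y' hy'
    by_contra hne
    obtain ⟨hm, hne⟩ := Set.indicator_apply_ne_zero.1 hne
    exact hy' (Finset.mem_filter.2 ⟨Finset.mem_Icc.2 ⟨pYiter_support (left_ne_zero_of_mul hne),
      pYker_support (right_ne_zero_of_mul hne)⟩, hm⟩)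

open Classical in
lemma qiter_succ (n : ℕ) (q : ℕ → ℝ) (t : ℕ) (x x'' : Fin (n + 1) → ℤ)
    (y y'' : Fin (n + 2) → ℤ) :
    qiter n q (t + 1) x y x'' y'' =
      ∑ y' ∈ (Finset.Icc y y'').filter Monotone, ∑ x' ∈ interlacing y',
        qiter n q t x y x' y' * qker n q x' y' x'' y'' := by
  have h := tsum_subtype
    {s : (Fin (n + 1) → ℤ) × (Fin (n + 2) → ℤ) | Monotone s.1 ∧ Monotone s.2 ∧ Interlace s.1 s.2}
    fun s => qiter n q t x y s.1 s.2 * qker n q s.1 s.2 x'' y''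
  refine h.trans ?_
  rw [Finset.sum_sigma', tsum_eq_sum
    (s := (((Finset.Icc y y'').filter Monotone).sigma fun y' => interlacing y').image
      fun s => (s.2, s.1))]
  · rw [Finset.sum_image]
    · refine Finset.sum_congr rfl fun s hs => Set.indicator_of_mem ?_ _
      obtain ⟨h1, h2⟩ := Finset.mem_sigma.1 hs
      have h2 := mem_interlacing.1 h2
      exact ⟨h2.monotone, (Finset.mem_filter.1 h1).2, h2⟩
    · rintro ⟨a, b⟩ - ⟨c, d⟩ - hab
      simp only [Prod.mk.injEq] at hab
      rw [hab.1, hab.2]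
  · rintro ⟨x', y'⟩ hs
    by_contra hne
    obtain ⟨⟨-, hm, hi⟩, hne⟩ := Set.indicator_apply_ne_zero.1 hne
    exact hs (Finset.mem_image.2 ⟨⟨y', x'⟩, Finset.mem_sigma.2 ⟨Finset.mem_filter.2
      ⟨Finset.mem_Icc.2 ⟨qiter_support (left_ne_zero_of_mul hne),
        qker_support (right_ne_zero_of_mul hne)⟩, hm⟩, mem_interlacing.2 hi⟩, rfl⟩)

lemma multi_step_intertwining_sum (n : ℕ) (q : ℕ → ℝ) (hq : ∀ i, 0 < q i) (t : ℕ)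
    {y y' : Fin (n + 2) → ℤ} {x' : Fin (n + 1) → ℤ}
    (hy' : Monotone y') (hx' : Interlace x' y') :
    mGeo n q x' y' * pYiter n q t y y' =
      ∑ x ∈ interlacing y, mGeo n q x y * qiter n q t x y x' y' := by
  classical
  induction t generalizing x' y' with
  | zero => exact one_step_intertwining n q hq hy' hx'
  | succ t ih =>
    simp only [pYiter_succ, qiter_succ, Finset.mul_sum]
    rw [Finset.sum_comm]
    refine Finset.sum_congr rfl fun z hz => ?_
    rw [Finset.sum_comm, mul_left_comm, one_step_intertwining n q hq hy' hx', Finset.mul_sum]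
    refine Finset.sum_congr rfl fun w hw => ?_
    rw [← mul_assoc, mul_comm (pYiter n q t y z),
      ih (Finset.mem_filter.1 hz).2 (mem_interlacing.1 hw), Finset.sum_mul]
    exact Finset.sum_congr rfl fun x _ => mul_assoc _ _ _

/-- Multi-step intertwining in the geometric-jump case: for every `t ≥ 1`
(`qiter n q t = q^{(t+1)}` and `pYiter n q t = p_Y^{(t+1)}`, so all `t ≥ 1` are covered),
`m(x′,y′)·p_Y^{(t)}(y,y′) = Σ_{x ⪯ y} m(x,y)·q^{(t)}((x,y),(x′,y′))`. -/
theorem geometric_multi_step_intertwining (n : ℕ) (q : ℕ → ℝ)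
    (hq : ∀ i, 0 < q i ∧ q i < 1) (t : ℕ)
    (y : Fin (n + 2) → ℤ) (hy : Monotone y)
    (x' : Fin (n + 1) → ℤ) (y' : Fin (n + 2) → ℤ)
    (hx' : Monotone x') (hy' : Monotone y') (hxy' : Interlace x' y') :
    mGeo n q x' y' * pYiter n q t y y' =
      ∑ᶠ x ∈ {x : Fin (n + 1) → ℤ | Monotone x ∧ Interlace x y},
        mGeo n q x y * qiter n q t x y x' y' := by
  have hset : {x : Fin (n + 1) → ℤ | Monotone x ∧ Interlace x y} = ↑(interlacing y) := by
    ext x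
    simpa [mem_interlacing] using fun h : Interlace x y => h.monotone
  rw [hset, finsum_mem_coe_finset]
  exact multi_step_intertwining_sum n q (fun i => (hq i).1) t hy' hxy'

end
end

section
/- Intertwining with a wall, even row to odd row (core of Theorem 5.2): for every n ≥ 1 and every q̃ = (q_1,…,q_{n+1}) ∈ (0,1)^{n+1}, writing q = (q_1,…,q_n), for every y ∈ W_0^{n+1} and every (x′,y′) ∈ W_0^{n,n+1}, one has Q_{2n+1}(y,y′) · m(x′,y′) = Σ_{x ∈ W_0^n : x ⪯ y} m(x,y) · A_0((x,y),(x′,y′)), i.e. Q_{2n+1} Λ = Λ A_0 where Λ(y,(x′,y′)) = m(x′,y′)·1{y′ = y}. -/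
open scoped BigOperators

noncomputable section

/-- Membership in `W₀^k = {0 ≤ z_1 ≤ z_2 ≤ ⋯ ≤ z_k}`. -/
def W0 {k : ℕ} (z : Fin k → ℤ) : Prop := Monotone z ∧ ∀ i, 0 ≤ z i

/-- `p` encodes an integer symplectic Gelfand–Tsetlin pattern with rows `1, …, n`,
row `r` having `⌈r/2⌉ = (r+1)/2` nonnegative entries `p r 0, …`; consecutive rows
satisfy `x^{2i-1} ≺ x^{2i}` and `x^{2i} ⪯ x^{2i+1}`; irrelevant entries are pinned to `0`. -/
def IsSymp (n : ℕ) (p : ℕ → ℕ → ℤ) : Prop :=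
  (∀ r i, 1 ≤ r → r ≤ n → i < (r + 1) / 2 → 0 ≤ p r i) ∧
  (∀ k, 1 ≤ k → 2 * k ≤ n →
    (∀ j, j < k → p (2 * k - 1) j ≤ p (2 * k) j) ∧
    (∀ j, j + 1 < k → p (2 * k) j ≤ p (2 * k - 1) (j + 1))) ∧
  (∀ k, 1 ≤ k → 2 * k + 1 ≤ n →
    (∀ j, j < k → p (2 * k + 1) j ≤ p (2 * k) j ∧ p (2 * k) j ≤ p (2 * k + 1) (j + 1))) ∧
  (∀ r i, r = 0 ∨ n < r ∨ (r + 1) / 2 ≤ i → p r i = 0)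

/-- `|x^r|`, the sum of the entries of row `r` (row `r` has `(r+1)/2` entries). -/
def rowSumS (p : ℕ → ℕ → ℤ) (r : ℕ) : ℤ := ∑ i ∈ Finset.range ((r + 1) / 2), p r i

/-- The geometric weight `w^q_n(x)`: each row `r` contributes
`q_{⌈r/2⌉}^{|x^r|−|x^{r−1}|}` if `r` is odd and `q_{r/2}^{−(|x^r|−|x^{r−1}|)}` if `r`
is even, which reproduces `w^q_{2k−1}` and `w^q_{2k}` (0-based rates). -/
def wSymp (n : ℕ) (q : ℕ → ℝ) (p : ℕ → ℕ → ℤ) : ℝ :=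
  ∏ r ∈ Finset.Icc 1 n,
    q ((r + 1) / 2 - 1) ^ ((if r % 2 = 1 then (1 : ℤ) else -1) * (rowSumS p r - rowSumS p (r - 1)))

/-- The symplectic Schur function `Sp^{2k−1}_z(q_1,…,q_k)`. -/
def SpOdd (k : ℕ) (q : ℕ → ℝ) (z : Fin k → ℤ) : ℝ :=
  ∑ᶠ p ∈ {p : ℕ → ℕ → ℤ | IsSymp (2 * k - 1) p ∧ ∀ i : Fin k, p (2 * k - 1) i = z i},
    wSymp (2 * k - 1) q p

/-- The symplectic Schur function `Sp^{2k}_z(q_1,…,q_k)`. -/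
def SpEven (k : ℕ) (q : ℕ → ℝ) (z : Fin k → ℤ) : ℝ :=
  ∑ᶠ p ∈ {p : ℕ → ℕ → ℤ | IsSymp (2 * k) p ∧ ∀ i : Fin k, p (2 * k) i = z i},
    wSymp (2 * k) q p

open Classical in
/-- The `Q`-matrix `Q_{2k−1}` on `W₀^k` (here `k = m+1`): jumps `x → x ± e_i` at rate
`Sp^{2k−1}_{x±e_i}(q)/Sp^{2k−1}_x(q)` whenever `x ± e_i ∈ W₀^k`, with diagonal
`−[Σ_{i=1}^{k−1}(q_i+q_i^{−1}) + q_k^{−1}·1{x_1>0} + q_k]`. -/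
def Qodd (m : ℕ) (q : ℕ → ℝ) (x x' : Fin (m + 1) → ℤ) : ℝ :=
  if x' = x then
    -((∑ i ∈ Finset.range m, (q i + (q i)⁻¹)) +
      (q m)⁻¹ * (if 0 < x 0 then 1 else 0) + q m)
  else if (∃ i, x' = x + Pi.single i 1 ∨ x' = x - Pi.single i 1) ∧ W0 x' then
    SpOdd (m + 1) q x' / SpOdd (m + 1) q x
  else 0

open Classical in
/-- The `Q`-matrix `Q_{2k}` on `W₀^k` (here `k = m+1`): jumps `x → x ± e_i` at rate
`Sp^{2k}_{x±e_i}(q)/Sp^{2k}_x(q)` whenever `x ± e_i ∈ W₀^k`, with diagonal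
`−Σ_{i=1}^{k}(q_i+q_i^{−1})`. -/
def Qeven (m : ℕ) (q : ℕ → ℝ) (x x' : Fin (m + 1) → ℤ) : ℝ :=
  if x' = x then -(∑ i ∈ Finset.range (m + 1), (q i + (q i)⁻¹))
  else if (∃ i, x' = x + Pi.single i 1 ∨ x' = x - Pi.single i 1) ∧ W0 x' then
    SpEven (m + 1) q x' / SpEven (m + 1) q x
  else 0

/-- `m(x,y) = q_{n+1}^{|y|−|x|} Sp^{2n}_x(q)/Sp^{2n+1}_y(q̃)` on `W₀^{n,n+1}` (here `n = m+1`). -/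
def mEO (m : ℕ) (q : ℕ → ℝ) (x : Fin (m + 1) → ℤ) (y : Fin (m + 2) → ℤ) : ℝ :=
  q (m + 1) ^ (vsum y - vsum x) * SpEven (m + 1) q x / SpOdd (m + 2) q y

open Classical in
/-- The `Q`-matrix `A₀` on `W₀^{n,n+1}` (here `n = m+1`), coupling an even row `X`
evolving by `Q_{2n}` with an odd row `Y`, with blocking and pushing. -/
def A0eo (m : ℕ) (q : ℕ → ℝ) (x : Fin (m + 1) → ℤ) (y : Fin (m + 2) → ℤ)
    (x' : Fin (m + 1) → ℤ) (y' : Fin (m + 2) → ℤ) : ℝ :=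
  if x' = x ∧ y' = y then
    -((∑ i ∈ Finset.range (m + 1), (q i + (q i)⁻¹)) +
      (∑ i : Fin (m + 1), (q (m + 1) * (if y i.castSucc < x i then (1 : ℝ) else 0) +
        (q (m + 1))⁻¹ * (if x i < y i.succ then (1 : ℝ) else 0))) +
      q (m + 1) + (q (m + 1))⁻¹ * (if 0 < y 0 then 1 else 0))
  else if (∃ i, x' = x + Pi.single i 1 ∨ x' = x - Pi.single i 1) ∧ y' = y then
    Qeven m q x x'
  else if ∃ i : Fin (m + 1), x' = x - Pi.single i 1 ∧ y' = y - Pi.single i.castSucc 1 ∧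
      x i = y i.castSucc then
    Qeven m q x x'
  else if ∃ i : Fin (m + 1), x' = x + Pi.single i 1 ∧ y' = y + Pi.single i.succ 1 ∧
      x i = y i.succ then
    Qeven m q x x'
  else if x' = x ∧ ∃ j, y' = y + Pi.single j 1 then q (m + 1)
  else if x' = x ∧ ∃ j, y' = y - Pi.single j 1 then (q (m + 1))⁻¹
  else 0

lemma wSymp_pos {n : ℕ} {q : ℕ → ℝ} (hq : ∀ i, 0 < q i) (p : ℕ → ℕ → ℤ) : 0 < wSymp n q p :=
  Finset.prod_pos fun _ _ => zpow_pos (hq _) _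

lemma IsSymp.le_of_top_le {n : ℕ} {p : ℕ → ℕ → ℤ} (hp : IsSymp n p) {M : ℤ}
    (hM : ∀ i, i < (n + 1) / 2 → p n i ≤ M) (d : ℕ) :
    ∀ r i, r + d = n → 1 ≤ r → i < (r + 1) / 2 → p r i ≤ M := by
  obtain ⟨-, h₂, h₃, -⟩ := hp
  induction d with
  | zero => intro r i hr _ hi; obtain rfl : r = n := by omega
            exact hM i hi
  | succ d ih =>
    intro r i hr h1 hi
    rcases Nat.even_or_odd' r with ⟨k, rfl | rfl⟩
    · exact ((h₃ k (by omega) (by omega) i (by omega)).2).trans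
        (ih (2 * k + 1) (i + 1) (by omega) (by omega) (by omega))
    · exact ((h₂ (k + 1) (by omega) (by omega)).1 i (by omega)).trans
        (ih (2 * (k + 1)) i (by omega) (by omega) (by omega))

lemma finite_isSymp_of_top (n : ℕ) (z : ℕ → ℤ) :
    {p : ℕ → ℕ → ℤ | IsSymp n p ∧ ∀ i < (n + 1) / 2, p n i = z i}.Finite := by
  obtain ⟨M, hM⟩ : ∃ M : ℤ, 0 ≤ M ∧ ∀ i < (n + 1) / 2, z i ≤ M :=
    ⟨∑ i ∈ Finset.range ((n + 1) / 2), |z i|, Finset.sum_nonneg fun _ _ => abs_nonneg _,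
      fun i hi => (le_abs_self _).trans (Finset.single_le_sum (f := fun i => |z i|)
        (fun _ _ => abs_nonneg _) (Finset.mem_range.2 hi))⟩
  refine Set.Finite.of_finite_image
    (f := fun p (r i : Fin (n + 1)) => p r i) ?_ ?_
  · refine (Set.finite_Icc (0 : Fin (n + 1) → Fin (n + 1) → ℤ) fun _ _ => M).subset ?_
    rintro _ ⟨p, ⟨hp, hz⟩, rfl⟩
    have key : ∀ r i : Fin (n + 1), 0 ≤ p r i ∧ p r i ≤ M := by
      intro r i
      by_cases h : (r : ℕ) = 0 ∨ n < r ∨ ((r : ℕ) + 1) / 2 ≤ i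
      · rw [hp.2.2.2 r i h]; exact ⟨le_rfl, hM.1⟩
      · push Not at h
        exact ⟨hp.1 r i (by omega) h.2.1 h.2.2,
          hp.le_of_top_le (fun i hi => (hz i hi).trans_le (hM.2 i hi)) (n - r) r i
            (by omega) (by omega) h.2.2⟩
    exact ⟨fun r i => (key r i).1, fun r i => (key r i).2⟩
  · rintro p ⟨hp, -⟩ p' ⟨hp', -⟩ h
    ext r i
    by_cases hri : r = 0 ∨ n < r ∨ (r + 1) / 2 ≤ i
    · rw [hp.2.2.2 r i hri, hp'.2.2.2 r i hri]
    · push Not at hri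
      exact congrFun (congrFun h ⟨r, by omega⟩) ⟨i, by omega⟩

lemma exists_isSymp_of_top {n : ℕ} (hn : 1 ≤ n) {z : ℕ → ℤ} (h0 : ∀ i < (n + 1) / 2, 0 ≤ z i)
    (hz : ∀ i, i + 1 < (n + 1) / 2 → z i ≤ z (i + 1)) :
    ∃ p : ℕ → ℕ → ℤ, IsSymp n p ∧ ∀ i < (n + 1) / 2, p n i = z i := by
  refine ⟨fun r i => if r = 0 ∨ n < r ∨ (r + 1) / 2 ≤ i then 0 else z i, ⟨?_, ?_, ?_, ?_⟩, ?_⟩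
  · intro r i h1 h2 h3
    dsimp only
    rw [if_neg (by omega)]
    exact h0 i (by omega)
  · refine fun k h1 h2 => ⟨fun j hj => ?_, fun j hj => ?_⟩
    · dsimp only
      rw [if_neg (by omega), if_neg (by omega)]
    · dsimp only
      rw [if_neg (by omega), if_neg (by omega)]
      exact hz j (by omega)
  · refine fun k h1 h2 j hj => ⟨?_, ?_⟩
    · dsimp only
      rw [if_neg (by omega), if_neg (by omega)]
    · dsimp only
      rw [if_neg (by omega), if_neg (by omega)]
      exact hz j (by omega)
  · exact fun r i h => if_pos h
  · exact fun i hi => if_neg (by omega)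

lemma finsum_wSymp_pos {n k : ℕ} (hn : 1 ≤ n) (hk : (n + 1) / 2 = k) {q : ℕ → ℝ}
    (hq : ∀ i, 0 < q i) {z : Fin k → ℤ} (hz : W0 z) :
    0 < ∑ᶠ p ∈ {p : ℕ → ℕ → ℤ | IsSymp n p ∧ ∀ i : Fin k, p n i = z i}, wSymp n q p := by
  let z' : ℕ → ℤ := fun i => if h : i < k then z ⟨i, h⟩ else 0
  have hset : {p : ℕ → ℕ → ℤ | IsSymp n p ∧ ∀ i : Fin k, p n i = z i} =
      {p : ℕ → ℕ → ℤ | IsSymp n p ∧ ∀ i < (n + 1) / 2, p n i = z' i} := by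
    subst hk
    ext p
    refine and_congr_right fun _ => ⟨fun h i hi => ?_, fun h i => ?_⟩
    · simpa [z', hi] using h ⟨i, hi⟩
    · simpa [z'] using h i i.2
  have hfin := finite_isSymp_of_top n z'
  rw [hset, finsum_mem_eq_finite_toFinset_sum _ hfin]
  refine Finset.sum_pos (fun p _ => wSymp_pos hq p) ?_
  obtain ⟨p, hp⟩ := exists_isSymp_of_top (z := z') hn
    (fun i hi => by simp only [z', dif_pos (hk ▸ hi)]; exact hz.2 _)
    (fun i hi => by
      have h1 : i + 1 < k := hk ▸ hi
      simp only [z', dif_pos h1, dif_pos (Nat.lt_of_succ_lt h1)]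
      exact hz.1 (by simp))
  exact ⟨p, hfin.mem_toFinset.2 hp⟩

lemma SpEven_pos {m : ℕ} {q : ℕ → ℝ} (hq : ∀ i, 0 < q i) {z : Fin (m + 1) → ℤ} (hz : W0 z) :
    0 < SpEven (m + 1) q z :=
  finsum_wSymp_pos (by omega) (by omega) hq hz

lemma SpOdd_pos {m : ℕ} {q : ℕ → ℝ} (hq : ∀ i, 0 < q i) {z : Fin (m + 1) → ℤ} (hz : W0 z) :
    0 < SpOdd (m + 1) q z :=
  finsum_wSymp_pos (by omega) (by omega) hq hz

lemma Interlace.w0 {n : ℕ} {x : Fin n → ℤ} {y : Fin (n + 1) → ℤ} (h : Interlace x y)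
    (hy : W0 y) : W0 x := by
  refine ⟨fun i j hij => ?_, fun i => (hy.2 _).trans (h i).1⟩
  rcases hij.eq_or_lt with rfl | hij
  · exact le_rfl
  · exact (h i).2.trans ((hy.1 (Fin.succ_le_castSucc_iff.2 hij)).trans (h j).1)

@[simp] lemma vsum_add_single {n : ℕ} (z : Fin n → ℤ) (i : Fin n) (c : ℤ) :
    vsum (z + Pi.single i c) = vsum z + c := by
  simp [vsum, Finset.sum_add_distrib]

@[simp] lemma vsum_sub_single {n : ℕ} (z : Fin n → ℤ) (i : Fin n) (c : ℤ) :
    vsum (z - Pi.single i c) = vsum z - c := by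
  simp [vsum, Finset.sum_sub_distrib]

lemma ne_add_single {n : ℕ} (z : Fin n → ℤ) (i : Fin n) : z ≠ z + Pi.single i 1 := fun h => by
  have := congrArg vsum h
  simp at this

lemma ne_sub_single {n : ℕ} (z : Fin n → ℤ) (i : Fin n) : z ≠ z - Pi.single i 1 := fun h => by
  have := congrArg vsum h
  simp only [vsum_sub_single] at this
  omega

lemma add_single_ne_sub_single {n : ℕ} (z : Fin n → ℤ) (i j : Fin n) :
    z + Pi.single i 1 ≠ z - Pi.single j 1 := fun h => by
  have := congrArg vsum h
  simp at this
  omega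

lemma single_one_inj {n : ℕ} {i j : Fin n} :
    (Pi.single i 1 : Fin n → ℤ) = Pi.single j 1 ↔ i = j := by
  refine ⟨fun h => ?_, fun h => h ▸ rfl⟩
  by_contra hij
  have := congrFun h i
  simp [hij] at this

open Classical in
lemma A0eo_self_right (m : ℕ) (q : ℕ → ℝ) (x x' : Fin (m + 1) → ℤ) (y : Fin (m + 2) → ℤ)
    (hx : x' ≠ x) : A0eo m q x y x' y = Qeven m q x x' := by
  by_cases h : ∃ i, x' = x + Pi.single i 1 ∨ x' = x - Pi.single i 1
  · simp [A0eo, hx, h]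
  · simp [A0eo, Qeven, hx, h]

open Classical in
lemma A0eo_add_single (m : ℕ) (q : ℕ → ℝ) (x x' : Fin (m + 1) → ℤ) (y : Fin (m + 2) → ℤ)
    (j : Fin (m + 2)) :
    A0eo m q x y x' (y + Pi.single j 1) =
      if ∃ i, x' = x + Pi.single i 1 ∧ j = i.succ ∧ x i = y i.succ then Qeven m q x x'
      else if x' = x then q (m + 1) else 0 := by
  have h : ∀ i, y + Pi.single j 1 ≠ y - Pi.single i 1 := add_single_ne_sub_single y j
  simp [A0eo, h, single_one_inj]

open Classical in
lemma A0eo_sub_single (m : ℕ) (q : ℕ → ℝ) (x x' : Fin (m + 1) → ℤ) (y : Fin (m + 2) → ℤ)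
    (j : Fin (m + 2)) :
    A0eo m q x y x' (y - Pi.single j 1) =
      if ∃ i : Fin (m + 1), x' = x - Pi.single i 1 ∧ j = i.castSucc ∧ x i = y i.castSucc then
        Qeven m q x x'
      else if x' = x then (q (m + 1))⁻¹ else 0 := by
  have h : ∀ i, y - Pi.single j 1 ≠ y + Pi.single i 1 :=
    fun i => (add_single_ne_sub_single y i j).symm
  simp [A0eo, h, single_one_inj]

lemma A0eo_eq_zero (m : ℕ) (q : ℕ → ℝ) (x x' : Fin (m + 1) → ℤ) {y y' : Fin (m + 2) → ℤ}
    (h : y' ≠ y) (hadd : ∀ j, y' ≠ y + Pi.single j 1) (hsub : ∀ j, y' ≠ y - Pi.single j 1) :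
    A0eo m q x y x' y' = 0 := by
  simp [A0eo, h, hadd, hsub]

lemma mEO_mul_Qeven {m : ℕ} {q : ℕ → ℝ} (hq : ∀ i, 0 < q i) {x x' : Fin (m + 1) → ℤ}
    (hx : W0 x) (hx' : W0 x') (y : Fin (m + 2) → ℤ)
    (h : ∃ i, x' = x + Pi.single i 1 ∨ x' = x - Pi.single i 1) :
    mEO m q x y * Qeven m q x x' =
      q (m + 1) ^ (vsum y - vsum x) * SpEven (m + 1) q x' / SpOdd (m + 2) q y := by
  have hne : x' ≠ x := by
    obtain ⟨i, rfl | rfl⟩ := h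
    · exact (ne_add_single x i).symm
    · exact (ne_sub_single x i).symm
  have := (SpEven_pos hq hx).ne'
  simp only [mEO, Qeven, hne, h, hx', and_self, if_true, if_false]
  field_simp

lemma Qodd_mul_mEO {m : ℕ} {q : ℕ → ℝ} (hq : ∀ i, 0 < q i) {y y' : Fin (m + 2) → ℤ}
    (hy' : W0 y') (x' : Fin (m + 1) → ℤ)
    (h : ∃ i, y' = y + Pi.single i 1 ∨ y' = y - Pi.single i 1) :
    Qodd (m + 1) q y y' * mEO m q x' y' =
      q (m + 1) ^ (vsum y' - vsum x') * SpEven (m + 1) q x' / SpOdd (m + 2) q y := by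
  have hne : y' ≠ y := by
    obtain ⟨i, rfl | rfl⟩ := h
    · exact (ne_add_single y i).symm
    · exact (ne_sub_single y i).symm
  have := (SpOdd_pos hq hy').ne'
  simp only [mEO, Qodd, hne, h, hy', and_self, if_true, if_false]
  field_simp

lemma interlace_add_single_iff {n : ℕ} {x : Fin n → ℤ} {y : Fin (n + 1) → ℤ}
    (h : Interlace x y) (i : Fin n) : Interlace (x + Pi.single i 1) y ↔ x i < y i.succ := by
  refine ⟨fun h' => by simpa [Int.add_one_le_iff] using (h' i).2, fun hi j => ?_⟩
  obtain ⟨h1, h2⟩ := h j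
  rcases eq_or_ne j i with rfl | hj
  · simp; omega
  · simp [hj, h1, h2]

lemma interlace_sub_single_iff {n : ℕ} {x : Fin n → ℤ} {y : Fin (n + 1) → ℤ}
    (h : Interlace x y) (i : Fin n) :
    Interlace (x - Pi.single i 1) y ↔ y i.castSucc < x i := by
  refine ⟨fun h' => by have := (h' i).1; simp at this; omega, fun hi j => ?_⟩
  obtain ⟨h1, h2⟩ := h j
  rcases eq_or_ne j i with rfl | hj
  · simp; omega
  · simp [hj, h1, h2]

lemma finite_interlace {n : ℕ} (y : Fin (n + 1) → ℤ) :
    {x : Fin n → ℤ | Interlace x y}.Finite :=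
  (Set.finite_Icc (fun i : Fin n => y i.castSucc) fun i => y i.succ).subset
    fun _ hx => ⟨fun i => (hx i).1, fun i => (hx i).2⟩

lemma setOf_w0_interlace {n : ℕ} {y : Fin (n + 1) → ℤ} (hy : W0 y) :
    {x : Fin n → ℤ | W0 x ∧ Interlace x y} = {x | Interlace x y} :=
  Set.ext fun _ => ⟨And.right, fun h => ⟨Interlace.w0 h hy, h⟩⟩

lemma intertwining_self {m : ℕ} {q : ℕ → ℝ} (hq : ∀ i, 0 < q i) {y : Fin (m + 2) → ℤ}
    (hy : W0 y) {x' : Fin (m + 1) → ℤ} (hxy : Interlace x' y) :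
    Qodd (m + 1) q y y * mEO m q x' y =
      ∑ᶠ x ∈ {x : Fin (m + 1) → ℤ | Interlace x y}, mEO m q x y * A0eo m q x y x' y := by
  classical
  have hx' := hxy.w0 hy
  have ha := (hq (m + 1)).ne'
  set C := mEO m q x' y with hC
  have hterm : ∀ x ∈ (finite_interlace y).toFinset, mEO m q x y * A0eo m q x y x' y =
      (if x = x' then C * A0eo m q x' y x' y else 0) +
      ((∑ i, if x = x' + Pi.single i 1 then C * (q (m + 1))⁻¹ else 0) +
        ∑ i, if x = x' - Pi.single i 1 then C * q (m + 1) else 0) := by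
    intro x hx
    have hxy : Interlace x y := by simpa using hx
    by_cases h0 : x = x'
    · subst h0
      simp [ne_sub_single, hC]
    by_cases h1 : ∃ i, x = x' + Pi.single i 1
    · obtain ⟨i, rfl⟩ := h1
      rw [A0eo_self_right _ _ _ _ _ (Ne.symm h0),
        mEO_mul_Qeven hq (hxy.w0 hy) hx' y ⟨i, Or.inr (by simp)⟩]
      simp only [h0, if_false, add_right_inj, single_one_inj, Finset.sum_ite_eq,
        Finset.mem_univ, if_true, add_single_ne_sub_single, Finset.sum_const_zero, zero_add,
        add_zero, vsum_add_single, hC, mEO]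
      rw [← sub_sub, zpow_sub_one₀ ha]
      ring
    by_cases h2 : ∃ i, x = x' - Pi.single i 1
    · obtain ⟨i, rfl⟩ := h2
      rw [A0eo_self_right _ _ _ _ _ (Ne.symm h0),
        mEO_mul_Qeven hq (hxy.w0 hy) hx' y ⟨i, Or.inl (by simp)⟩]
      simp only [h0, if_false, sub_right_inj, single_one_inj, Finset.sum_ite_eq,
        Finset.mem_univ, if_true, (add_single_ne_sub_single _ _ _).symm, Finset.sum_const_zero,
        zero_add, vsum_sub_single, hC, mEO]
      rw [← sub_add, zpow_add_one₀ ha]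
      ring
    · rw [A0eo_self_right _ _ _ _ _ (Ne.symm h0)]
      push Not at h1 h2
      have hno : ¬ ∃ i, x' = x + Pi.single i 1 ∨ x' = x - Pi.single i 1 := by
        rintro ⟨i, h | h⟩
        · exact h2 i (by simp [h])
        · exact h1 i (by simp [h])
      simp [Qeven, h0, h1, h2, hno, Ne.symm h0]
  rw [finsum_mem_eq_finite_toFinset_sum _ (finite_interlace y), Finset.sum_congr rfl hterm,
    Finset.sum_add_distrib, Finset.sum_add_distrib, Finset.sum_comm,
    Finset.sum_comm (s := (finite_interlace y).toFinset)]
  simp only [Finset.sum_ite_eq', Set.Finite.mem_toFinset, Set.mem_ofPred_eq, hxy, if_true,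
    interlace_add_single_iff hxy, interlace_sub_single_iff hxy]
  simp only [A0eo, Qodd, and_self, if_true, Finset.sum_add_distrib, ← mul_boole (_ < _) (C * _),
    ← Finset.mul_sum]
  ring

lemma intertwining_add_single {m : ℕ} {q : ℕ → ℝ} (hq : ∀ i, 0 < q i) {y : Fin (m + 2) → ℤ}
    (hy : W0 y) {x' : Fin (m + 1) → ℤ} (hx' : W0 x') (j : Fin (m + 2))
    (hy' : W0 (y + Pi.single j 1)) (hxy' : Interlace x' (y + Pi.single j 1)) :
    Qodd (m + 1) q y (y + Pi.single j 1) * mEO m q x' (y + Pi.single j 1) =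
      ∑ᶠ x ∈ {x : Fin (m + 1) → ℤ | Interlace x y},
        mEO m q x y * A0eo m q x y x' (y + Pi.single j 1) := by
  have ha := (hq (m + 1)).ne'
  rw [Qodd_mul_mEO hq hy' x' ⟨j, Or.inl rfl⟩,
    finsum_mem_eq_finite_toFinset_sum _ (finite_interlace y), vsum_add_single]
  by_cases hxy : Interlace x' y
  · have hno : ∀ x : Fin (m + 1) → ℤ, ¬ ∃ i : Fin (m + 1), x' = x + Pi.single i 1 ∧ j = i.succ ∧
        x i = y i.succ := by
      rintro x ⟨i, rfl, -, h⟩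
      have := (hxy i).2
      simp [h] at this
    rw [Finset.sum_eq_single_of_mem x' (by simpa using hxy)
      fun x _ hx => by rw [A0eo_add_single, if_neg (hno x), if_neg hx.symm, mul_zero],
      A0eo_add_single, if_neg (hno x'), if_pos rfl, mEO, add_sub_right_comm, zpow_add_one₀ ha]
    ring
  · obtain ⟨i, rfl, hi⟩ : ∃ i : Fin (m + 1), j = i.succ ∧ x' i = y i.succ + 1 := by
      by_contra! hcon
      refine hxy fun i => ?_
      obtain ⟨h1, h2⟩ := hxy' i
      have h3 := hcon i
      simp only [Pi.add_apply, Pi.single_apply] at h1 h2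
      constructor
      · split_ifs at h1 <;> omega
      · split_ifs at h2 with h
        · have := h3 h.symm; omega
        · omega
    have hX : Interlace (x' - Pi.single i 1) y := by
      intro k
      obtain ⟨h1, h2⟩ := hxy' k
      have h4 := hy.1 (Fin.castSucc_le_succ i)
      simp only [Pi.add_apply, Pi.single_apply, Fin.succ_inj, Pi.sub_apply] at h1 h2 ⊢
      rcases eq_or_ne k i with rfl | hk
      · simp; omega
      · simp only [hk, if_false] at h2 ⊢
        split_ifs at h1 <;> omega
    rw [Finset.sum_eq_single_of_mem (x' - Pi.single i 1) (by simpa using hX),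
      A0eo_add_single, if_pos ⟨i, by simp, rfl, by simp [hi]⟩,
      mEO_mul_Qeven hq (hX.w0 hy) hx' y ⟨i, Or.inl (by simp)⟩, vsum_sub_single]
    · congr 3; ring
    · intro x hx hne
      rw [A0eo_add_single, if_neg, if_neg, mul_zero]
      · rintro rfl
        exact hxy (by simpa using hx)
      · rintro ⟨k, rfl, hk, -⟩
        obtain rfl := Fin.succ_injective _ hk
        exact hne (by simp)

lemma intertwining_sub_single {m : ℕ} {q : ℕ → ℝ} (hq : ∀ i, 0 < q i) {y : Fin (m + 2) → ℤ}
    (hy : W0 y) {x' : Fin (m + 1) → ℤ} (hx' : W0 x') (j : Fin (m + 2))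
    (hy' : W0 (y - Pi.single j 1)) (hxy' : Interlace x' (y - Pi.single j 1)) :
    Qodd (m + 1) q y (y - Pi.single j 1) * mEO m q x' (y - Pi.single j 1) =
      ∑ᶠ x ∈ {x : Fin (m + 1) → ℤ | Interlace x y},
        mEO m q x y * A0eo m q x y x' (y - Pi.single j 1) := by
  have ha := (hq (m + 1)).ne'
  rw [Qodd_mul_mEO hq hy' x' ⟨j, Or.inr rfl⟩,
    finsum_mem_eq_finite_toFinset_sum _ (finite_interlace y), vsum_sub_single]
  by_cases hxy : Interlace x' y
  · have hno : ∀ x : Fin (m + 1) → ℤ, ¬ ∃ i : Fin (m + 1), x' = x - Pi.single i 1 ∧ j = i.castSucc ∧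
        x i = y i.castSucc := by
      rintro x ⟨i, rfl, -, h⟩
      have := (hxy i).1
      simp [h] at this
    rw [Finset.sum_eq_single_of_mem x' (by simpa using hxy)
      fun x _ hx => by rw [A0eo_sub_single, if_neg (hno x), if_neg hx.symm, mul_zero],
      A0eo_sub_single, if_neg (hno x'), if_pos rfl, mEO, sub_right_comm, zpow_sub_one₀ ha]
    ring
  · obtain ⟨i, rfl, hi⟩ : ∃ i : Fin (m + 1), j = i.castSucc ∧ x' i = y i.castSucc - 1 := by
      by_contra! hcon
      refine hxy fun i => ?_
      obtain ⟨h1, h2⟩ := hxy' i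
      have h3 := hcon i
      simp only [Pi.sub_apply, Pi.single_apply] at h1 h2
      constructor
      · split_ifs at h1 with h
        · have := h3 h.symm; omega
        · omega
      · split_ifs at h2 <;> omega
    have hX : Interlace (x' + Pi.single i 1) y := by
      intro k
      obtain ⟨h1, h2⟩ := hxy' k
      have h4 := hy.1 (Fin.castSucc_le_succ i)
      simp only [Pi.add_apply, Pi.single_apply, Fin.castSucc_inj, Pi.sub_apply] at h1 h2 ⊢
      rcases eq_or_ne k i with rfl | hk
      · simp; omega
      · simp only [hk, if_false] at h1 ⊢
        split_ifs at h2 <;> omega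
    rw [Finset.sum_eq_single_of_mem (x' + Pi.single i 1) (by simpa using hX),
      A0eo_sub_single, if_pos ⟨i, by simp, rfl, by simp [hi]⟩,
      mEO_mul_Qeven hq (hX.w0 hy) hx' y ⟨i, Or.inr (by simp)⟩, vsum_add_single]
    · congr 3; ring
    · intro x hx hne
      rw [A0eo_sub_single, if_neg, if_neg, mul_zero]
      · rintro rfl
        exact hxy (by simpa using hx)
      · rintro ⟨k, rfl, hk, -⟩
        obtain rfl := Fin.castSucc_injective _ hk
        exact hne (by simp)

/-- Intertwining with a wall, even row to odd row: `Q_{2n+1} Λ = Λ A₀`, i.e.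
`Q_{2n+1}(y,y′)·m(x′,y′) = Σ_{x ∈ W₀^n, x ⪯ y} m(x,y)·A₀((x,y),(x′,y′))` (here `n = m+1`;
`Q_{2n+1} = Qodd (m+1)` acts on `W₀^{n+1}`). -/
theorem wall_intertwining_even_to_odd (m : ℕ) (q : ℕ → ℝ)
    (hq : ∀ i, 0 < q i ∧ q i < 1)
    (y : Fin (m + 2) → ℤ) (hy : W0 y)
    (x' : Fin (m + 1) → ℤ) (y' : Fin (m + 2) → ℤ)
    (hx' : W0 x') (hy' : W0 y') (hxy' : Interlace x' y') :
    Qodd (m + 1) q y y' * mEO m q x' y' =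
      ∑ᶠ x ∈ {x : Fin (m + 1) → ℤ | W0 x ∧ Interlace x y},
        mEO m q x y * A0eo m q x y x' y' := by
  have hq0 : ∀ i, 0 < q i := fun i => (hq i).1
  rw [setOf_w0_interlace hy]
  by_cases h0 : y' = y
  · subst h0
    exact intertwining_self hq0 hy hxy'
  by_cases h1 : ∃ j, y' = y + Pi.single j 1
  · obtain ⟨j, rfl⟩ := h1
    exact intertwining_add_single hq0 hy hx' j hy' hxy'
  by_cases h2 : ∃ j, y' = y - Pi.single j 1
  · obtain ⟨j, rfl⟩ := h2
    exact intertwining_sub_single hq0 hy hx' j hy' hxy'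
  push Not at h1 h2
  simp [A0eo_eq_zero m q _ x' h0 h1 h2, Qodd, h0, h1, h2]

end
end
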